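/- Assume the Riemann Hypothesis, and assume that for all t > 7 the function F(t) = −Re(η'/η)(1/2 + it) is strictly positive, where η(s) = π^(-s/2) Γ(s/2) ζ'(s). Then for consecutive ordinates γ_n < γ_{n+1} of zeros of ζ on the critical line with γ_n > 7, the integral ∫_{γ_n}^{γ_{n+1}} F(t) dt equals π. -/

import Mathlib

open Complex MeasureTheory

noncomputable def zhangEta (s : ℂ) : ℂ :=
  (Real.pi : ℂ) ^ (-s / 2) * Complex.Gamma (s / 2) * deriv riemannZeta s

noncomputable def zhangF (t : ℝ) : ℝ :=
  -(deriv zhangEta (1 / 2 + t * I) / zhangEta (1 / 2 + t * I)).re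

lemma zh_step (y u : ℝ) (hy : 7 / 2 ≤ y) (hu : 0 ≤ u) :
    u / (u ^ 2 + y ^ 2) ≤
      (Real.log ((u + 1) ^ 2 - (u + 1) + y ^ 2) - Real.log (u ^ 2 - u + y ^ 2)) / 2 := by
  have hB : 0 < u ^ 2 - u + y ^ 2 := by nlinarith [sq_nonneg (u - 1 / 2)]
  have hA : 0 < (u + 1) ^ 2 - (u + 1) + y ^ 2 := by nlinarith
  have h := Real.le_log_one_add_of_nonneg (x := 2 * u / (u ^ 2 - u + y ^ 2)) (by positivity)
  have e1 : 1 + 2 * u / (u ^ 2 - u + y ^ 2)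
      = ((u + 1) ^ 2 - (u + 1) + y ^ 2) / (u ^ 2 - u + y ^ 2) := by
    rw [eq_div_iff hB.ne', add_mul, div_mul_cancel₀ _ hB.ne']; ring
  have hC : 0 < u ^ 2 + y ^ 2 := by nlinarith
  have e2 : 2 * (2 * u / (u ^ 2 - u + y ^ 2)) / (2 * u / (u ^ 2 - u + y ^ 2) + 2)
      = 2 * (u / (u ^ 2 + y ^ 2)) := by
    have : 2 * u / (u ^ 2 - u + y ^ 2) + 2 = 2 * (u ^ 2 + y ^ 2) / (u ^ 2 - u + y ^ 2) := by
      rw [eq_div_iff hB.ne', add_mul, div_mul_cancel₀ _ hB.ne']; ring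
    rw [this, mul_div_assoc', div_div_div_cancel_right₀ hB.ne', mul_div_mul_left _ _ two_ne_zero,
      mul_div_assoc]
  rw [e1, e2, Real.log_div hA.ne' hB.ne'] at h
  linarith

lemma zh_sum (y x : ℝ) (hy : 7 / 2 ≤ y) (hx : 0 ≤ x) (m : ℕ) :
    ∑ j ∈ Finset.range m, (x + j) / ((x + j) ^ 2 + y ^ 2) ≤
      (Real.log ((x + m) ^ 2 - (x + m) + y ^ 2) - Real.log (x ^ 2 - x + y ^ 2)) / 2 := by
  induction m with
  | zero => simp
  | succ k ih =>
    rw [Finset.sum_range_succ]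
    have h := zh_step y (x + k) hy (by positivity)
    push_cast
    rw [← add_assoc]
    linarith

noncomputable def zhL (y : ℝ) (n : ℕ) (x : ℝ) : ℝ :=
  x * Real.log n + Real.log (n.factorial) -
    ∑ j ∈ Finset.range (n + 1), Real.log ((x + j) ^ 2 + y ^ 2) / 2

lemma zhL_hasDeriv (y : ℝ) (hy : 7 / 2 ≤ y) (n : ℕ) (x : ℝ) :
    HasDerivAt (zhL y n)
      (Real.log n - ∑ j ∈ Finset.range (n + 1), (x + j) / ((x + j) ^ 2 + y ^ 2)) x := by
  have h1 : HasDerivAt (fun x : ℝ => x * Real.log n + Real.log (n.factorial)) (Real.log n) x := by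
    simpa using ((hasDerivAt_id x).mul_const (Real.log n)).add_const (Real.log (n.factorial))
  refine h1.sub ?_
  refine HasDerivAt.fun_sum fun j _ => ?_
  have hp : (x + j) ^ 2 + y ^ 2 ≠ 0 := by nlinarith [sq_nonneg (x + j)]
  have h2 : HasDerivAt (fun x : ℝ => (x + j) ^ 2 + y ^ 2) (2 * (x + j)) x := by
    simpa using (((hasDerivAt_id x).add_const (j : ℝ)).pow 2).add_const (y ^ 2)
  refine ((h2.log hp).div_const 2).congr_deriv ?_
  field_simp

noncomputable def zhc (y : ℝ) (n : ℕ) : ℝ :=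
  Real.log n - Real.log ((n + 2) ^ 2 + y ^ 2) / 2 + Real.log 12 / 2

lemma zhL_deriv_ge (y : ℝ) (hy : 7 / 2 ≤ y) (n : ℕ) (x : ℝ) (hx : 0 ≤ x) (hx1 : x ≤ 1) :
    zhc y n ≤ Real.log n - ∑ j ∈ Finset.range (n + 1), (x + j) / ((x + j) ^ 2 + y ^ 2) := by
  have h := zh_sum y x hy hx (n + 1)
  have h2 : Real.log 12 ≤ Real.log (x ^ 2 - x + y ^ 2) :=
    Real.log_le_log (by norm_num) (by nlinarith [sq_nonneg (x - 1 / 2)])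
  have hn : (0 : ℝ) ≤ n := n.cast_nonneg
  have h3 : Real.log ((x + (n + 1 : ℕ)) ^ 2 - (x + (n + 1 : ℕ)) + y ^ 2)
      ≤ Real.log ((n + 2) ^ 2 + y ^ 2) := by
    push_cast
    apply Real.log_le_log
    · nlinarith [sq_nonneg (x + (n + 1) - 1 / 2)]
    · nlinarith
  unfold zhc
  linarith

lemma zhL_diff (y : ℝ) (hy : 7 / 2 ≤ y) (n : ℕ) (a b : ℝ) (ha : 0 ≤ a) (hab : a ≤ b) (hb : b ≤ 1) :
    zhc y n * (b - a) ≤ zhL y n b - zhL y n a := by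
  refine (convex_Icc (0 : ℝ) 1).mul_sub_le_image_sub_of_le_deriv
    (fun x _ => (zhL_hasDeriv y hy n x).continuousAt.continuousWithinAt)
    (fun x _ => (zhL_hasDeriv y hy n x).differentiableAt.differentiableWithinAt)
    (fun x hx => ?_) a ⟨ha, hab.trans hb⟩ b ⟨ha.trans hab, hb⟩ hab
  rw [(zhL_hasDeriv y hy n x).deriv]
  have := interior_subset hx
  exact zhL_deriv_ge y hy n x this.1 this.2

lemma zhc_tendsto (y : ℝ) :
    Filter.Tendsto (zhc y) Filter.atTop (nhds (Real.log 12 / 2)) := by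
  have h0 : Filter.Tendsto (fun n : ℕ => ((n : ℝ))⁻¹) Filter.atTop (nhds 0) :=
    tendsto_inv_atTop_nhds_zero_nat
  have h1 : Filter.Tendsto (fun n : ℕ => (1 + 2 * (n : ℝ)⁻¹) ^ 2 + (y * (n : ℝ)⁻¹) ^ 2)
      Filter.atTop (nhds ((1 + 2 * 0) ^ 2 + (y * 0) ^ 2)) :=
    (((h0.const_mul 2).const_add 1).pow 2).add ((h0.const_mul y).pow 2)
  have h2 := (((Filter.Tendsto.log h1 (by norm_num)).div_const 2).const_sub 0).add_const
    (Real.log 12 / 2)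
  simp only [mul_zero, add_zero, one_pow, ne_eq, OfNat.ofNat_ne_zero, not_false_eq_true, zero_pow,
    Real.log_one, zero_div, sub_zero, zero_add] at h2
  refine h2.congr' ?_
  filter_upwards [Filter.eventually_gt_atTop 0] with n hn
  have hn' : (0 : ℝ) < n := by exact_mod_cast hn
  have : (1 + 2 * (n : ℝ)⁻¹) ^ 2 + (y * (n : ℝ)⁻¹) ^ 2 = ((n + 2) ^ 2 + y ^ 2) / n ^ 2 := by
    field_simp
  rw [this, Real.log_div (by positivity) (by positivity), Real.log_pow]
  unfold zhc
  push_cast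
  ring

lemma zhL_eq (y : ℝ) (hy : 7 / 2 ≤ y) (n : ℕ) (hn : 0 < n) (x : ℝ) :
    zhL y n x = Real.log ‖GammaSeq (x + y * I) n‖ := by
  have hne : ∀ j : ℕ, ((x : ℂ) + y * I + j) ≠ 0 := by
    intro j h
    have := congrArg Complex.im h
    simp at this
    linarith
  have hnorm : ∀ j : ℕ, Real.log ‖(x : ℂ) + y * I + j‖ = Real.log ((x + j) ^ 2 + y ^ 2) / 2 := by
    intro j
    have : (x : ℂ) + y * I + j = ((x + j : ℝ) : ℂ) + y * I := by push_cast; ring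
    rw [this, Complex.norm_add_mul_I, Real.log_sqrt (by positivity)]
  have hn' : (0 : ℝ) < n := by exact_mod_cast hn
  unfold GammaSeq zhL
  rw [norm_div, norm_mul, norm_prod, norm_natCast, Real.log_div, Real.log_mul, Real.log_prod]
  · simp_rw [hnorm]
    rw [norm_natCast_cpow_of_pos hn, Real.log_rpow hn']
    simp
  · intro j _; exact norm_ne_zero_iff.mpr (hne j)
  · rw [norm_natCast_cpow_of_pos hn]; positivity
  · positivity
  · rw [norm_natCast_cpow_of_pos hn]; positivity
  · exact Finset.prod_ne_zero_iff.mpr fun j _ => norm_ne_zero_iff.mpr (hne j)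

lemma zh_Gamma_ne (x y : ℝ) (hy : 7 / 2 ≤ y) : ∀ m : ℕ, (x : ℂ) + y * I ≠ -m := by
  intro m h
  have := congrArg Complex.im h
  simp at this
  linarith

lemma zh_Gamma_diff (y : ℝ) (hy : 7 / 2 ≤ y) (a b : ℝ) (ha : 0 ≤ a) (hab : a ≤ b) (hb : b ≤ 1) :
    Real.log 12 / 2 * (b - a) ≤
      Real.log ‖Gamma (b + y * I)‖ - Real.log ‖Gamma (a + y * I)‖ := by
  have hlim : ∀ x : ℝ, Filter.Tendsto (fun n => zhL y n x) Filter.atTop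
      (nhds (Real.log ‖Gamma (x + y * I)‖)) := by
    intro x
    have := ((GammaSeq_tendsto_Gamma (x + y * I)).norm).log
      (norm_ne_zero_iff.mpr (Gamma_ne_zero (zh_Gamma_ne x y hy)))
    refine this.congr' ?_
    filter_upwards [Filter.eventually_gt_atTop 0] with n hn
    exact (zhL_eq y hy n hn x).symm
  exact le_of_tendsto_of_tendsto' ((zhc_tendsto y).mul_const (b - a)) ((hlim b).sub (hlim a))
    fun n => zhL_diff y hy n a b ha hab hb

lemma zh_log_norm_deriv (f : ℝ → ℂ) (f' : ℂ) (x : ℝ) (hf : HasDerivAt f f' x) (h0 : f x ≠ 0) :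
    HasDerivAt (fun x => Real.log ‖f x‖) (f' / f x).re x := by
  have hre : HasDerivAt (fun x => (f x).re) f'.re x := by
    exact (Complex.reCLM.hasFDerivAt.comp_hasDerivAt x hf)
  have him : HasDerivAt (fun x => (f x).im) f'.im x := by
    exact (Complex.imCLM.hasFDerivAt.comp_hasDerivAt x hf)
  have hN : Complex.normSq (f x) ≠ 0 := by simpa using h0
  have hs : HasDerivAt (fun x => Complex.normSq (f x))
      (2 * (f x).re * f'.re + 2 * (f x).im * f'.im) x := by
    have := (hre.mul hre).add (him.mul him)
    simp only [Complex.normSq_apply]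
    refine this.congr_deriv ?_
    ring
  have h := (hs.log hN).div_const 2
  have e : (fun x => Real.log ‖f x‖) = fun x => Real.log (Complex.normSq (f x)) / 2 := by
    ext x
    rw [Complex.norm_def, Real.log_sqrt (Complex.normSq_nonneg _)]
  rw [e]
  refine h.congr_deriv ?_
  · rw [Complex.div_re]
    field_simp

lemma zh_digamma (y : ℝ) (hy : 7 / 2 ≤ y) (x : ℝ) (hx : 0 ≤ x) (hx1 : x < 1) :
    Real.log 12 / 2 ≤ (deriv Gamma (x + y * I) / Gamma (x + y * I)).re := by
  have hd : HasDerivAt (fun x : ℝ => Gamma (x + y * I)) (deriv Gamma (x + y * I)) x := by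
    have h1 := (differentiableAt_Gamma _ (zh_Gamma_ne x y hy)).hasDerivAt
    have h2 : HasDerivAt (fun x : ℝ => (x : ℂ) + y * I) 1 x := by
      simpa using (Complex.ofRealCLM.hasDerivAt (x := x)).add_const ((y : ℂ) * I)
    exact (HasDerivAt.comp x (h₂ := Gamma) h1 h2).congr_deriv (mul_one _)
  have h := zh_log_norm_deriv _ _ x hd (Gamma_ne_zero (zh_Gamma_ne x y hy))
  have hsl := (hasDerivAt_iff_tendsto_slope.mp h).mono_left
    (nhdsWithin_mono x (fun z (hz : z ∈ Set.Ioi x) => ne_of_gt hz))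
  refine ge_of_tendsto hsl ?_
  filter_upwards [Ioo_mem_nhdsGT hx1] with b hb
  rw [slope_def_field, le_div_iff₀ (by linarith [hb.1])]
  exact zh_Gamma_diff y hy x b hx hb.1.le hb.2.le

lemma zh_log_pi : Real.log Real.pi < Real.log 12 / 2 := by
  have : Real.log (Real.pi ^ 2) < Real.log 12 :=
    Real.log_lt_log (by positivity) (by nlinarith [Real.pi_lt_d2, Real.pi_pos])
  rw [Real.log_pow] at this
  push_cast at this
  linarith

open ComplexConjugate in
lemma zh_Lambda_real (t : ℝ) (ht : 7 < t) :
    (completedRiemannZeta (1 / 2 + t * I)).im = 0 := by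
  set s : ℂ := 1 / 2 + t * I with hs
  have hs0 : s ≠ 0 := by
    intro h
    have := congrArg Complex.re h
    simp [hs] at this
  have hG : ∀ s : ℂ, Gammaℝ (conj s) = conj (Gammaℝ s) := by
    intro s
    have hpi : (Real.pi : ℂ).arg ≠ Real.pi := by
      rw [Complex.arg_ofReal_of_nonneg Real.pi_pos.le]; exact Real.pi_pos.ne
    have e1 : -(conj s) / 2 = conj (-s / 2) := by
      rw [map_div₀, map_neg, Complex.conj_ofNat]
    have e2 : (conj s) / 2 = conj (s / 2) := by
      rw [map_div₀, Complex.conj_ofNat]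
    rw [Gammaℝ_def, Gammaℝ_def, e1, e2, Complex.Gamma_conj, Complex.cpow_conj _ _ hpi,
      Complex.conj_ofReal, map_mul]
  have hre : 0 < s.re := by simp [hs]
  have hΛ : completedRiemannZeta s = riemannZeta s * Gammaℝ s := by
    rw [riemannZeta_def_of_ne_zero hs0, div_mul_cancel₀ _ (Gammaℝ_ne_zero_of_re_pos hre)]
  have hc0 : conj s ≠ 0 := by simpa using hs0
  have hΛ' : completedRiemannZeta (conj s) = riemannZeta (conj s) * Gammaℝ (conj s) := by
    rw [riemannZeta_def_of_ne_zero hc0,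
      div_mul_cancel₀ _ (Gammaℝ_ne_zero_of_re_pos (by simpa using hre))]
  have h1 : conj s = 1 - s := by
    apply Complex.ext <;> simp [hs]
    norm_num
  have h2 : conj (completedRiemannZeta s) = completedRiemannZeta s := by
    have h3 : completedRiemannZeta (conj s) = conj (completedRiemannZeta s) := by
      rw [hΛ', riemannZeta_conj, hG, ← map_mul, ← hΛ]
    rw [← h3, h1, completedRiemannZeta_one_sub]
  exact Complex.conj_eq_iff_im.mp h2

lemma zh_path (t : ℝ) : HasDerivAt (fun t : ℝ => (1 / 2 : ℂ) + t * I) I t := by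
  have := ((Complex.ofRealCLM.hasDerivAt (x := t)).mul_const I).const_add (1 / 2 : ℂ)
  exact this.congr_deriv (by simp)

lemma zh_ne_zero (t : ℝ) : (1 / 2 : ℂ) + t * I ≠ 0 := by
  intro h
  have := congrArg Complex.re h
  simp at this

lemma zh_ne_one (t : ℝ) : (1 / 2 : ℂ) + t * I ≠ 1 := by
  intro h
  have := congrArg Complex.re h
  norm_num at this

lemma zh_half (t : ℝ) : ((1 / 2 : ℂ) + t * I) / 2 = ((1 / 4 : ℝ) : ℂ) + ((t / 2 : ℝ) : ℂ) * I := by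
  push_cast; ring

lemma zh_Lambda_deriv (t : ℝ) (ht : 7 < t) :
    (deriv completedRiemannZeta (1 / 2 + t * I)).re = 0 := by
  have h1 := (differentiableAt_completedZeta (zh_ne_zero t) (zh_ne_one t)).hasDerivAt
  have h2 : HasDerivAt (fun t : ℝ => completedRiemannZeta (1 / 2 + t * I))
    (deriv completedRiemannZeta (1 / 2 + t * I) * I) t :=
    HasDerivAt.comp t (h₂ := completedRiemannZeta) h1 (zh_path t)
  have h3 : HasDerivAt (fun t : ℝ => (completedRiemannZeta (1 / 2 + t * I)).im)
    (deriv completedRiemannZeta (1 / 2 + t * I) * I).im t :=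
    (Complex.imCLM.hasFDerivAt.comp_hasDerivAt t h2)
  have h4 : HasDerivAt (fun t : ℝ => (completedRiemannZeta (1 / 2 + t * I)).im) 0 t := by
    refine (hasDerivAt_const t (0 : ℝ)).congr_of_eventuallyEq ?_
    filter_upwards [lt_mem_nhds ht] with u hu
    exact zh_Lambda_real u hu
  have := h3.unique h4
  simpa using this

lemma zh_GammaR (t : ℝ) (ht : 7 < t) :
    ∃ d : ℂ, HasDerivAt Gammaℝ (d * Gammaℝ (1 / 2 + t * I)) (1 / 2 + t * I) ∧ 0 < d.re := by
  set s : ℂ := 1 / 2 + t * I with hs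
  have hpi : (Real.pi : ℂ) ≠ 0 := by exact_mod_cast Real.pi_ne_zero
  have hne : ∀ m : ℕ, s / 2 ≠ -m := by
    rw [hs, zh_half]; exact zh_Gamma_ne _ _ (by linarith)
  have hdig := zh_digamma (t / 2) (by linarith) (1 / 4) (by norm_num) (by norm_num)
  rw [← zh_half, ← hs] at hdig
  refine ⟨-(Real.log Real.pi : ℂ) / 2 + deriv Gamma (s / 2) / Gamma (s / 2) / 2, ?_, ?_⟩
  · have h1 : HasDerivAt (fun s : ℂ => -s / 2) (-1 / 2) s := ((hasDerivAt_id s).neg).div_const 2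
    have h2 := h1.const_cpow (c := (Real.pi : ℂ)) (Or.inl hpi)
    have h3 : HasDerivAt (fun s : ℂ => s / 2) (1 / 2) s := (hasDerivAt_id s).div_const 2
    have h4 : HasDerivAt (fun s : ℂ => Gamma (s / 2)) (deriv Gamma (s / 2) * (1 / 2)) s :=
      HasDerivAt.comp s (h₂ := Gamma) (differentiableAt_Gamma _ hne).hasDerivAt h3
    have h5 := h2.mul h4
    refine h5.congr_deriv ?_
    have hG := Gamma_ne_zero hne
    rw [Gammaℝ_def, Complex.ofReal_log Real.pi_pos.le]
    field_simp
  · have := zh_log_pi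
    have e : (-(Real.log Real.pi : ℂ) / 2).re = -Real.log Real.pi / 2 := by
      rw [← Complex.ofReal_neg, Complex.div_ofNat_re, Complex.ofReal_re]
    rw [Complex.add_re, e, Complex.div_ofNat_re]
    linarith

lemma zh_eta_eq (s : ℂ) : zhangEta s = Gammaℝ s * deriv riemannZeta s := rfl

lemma zh_eta_re (t : ℝ) (ht : 7 < t) : ∃ c : ℝ, 0 < c ∧
    (zhangEta (1 / 2 + t * I)).re = -c * (completedRiemannZeta (1 / 2 + t * I)).re := by
  obtain ⟨d, hd, hd0⟩ := zh_GammaR t ht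
  refine ⟨d.re, hd0, ?_⟩
  have hz := (differentiableAt_riemannZeta (zh_ne_one t)).hasDerivAt
  have hp := hd.mul hz
  have hloc : completedRiemannZeta =ᶠ[nhds (1 / 2 + t * I)] Gammaℝ * riemannZeta := by
    have : {s : ℂ | 0 < s.re} ∈ nhds ((1 / 2 : ℂ) + t * I) :=
      (isOpen_lt continuous_const Complex.continuous_re).mem_nhds (by simp)
    filter_upwards [this] with s hs
    have hs0 : s ≠ 0 := by rintro rfl; simp at hs
    rw [Pi.mul_apply, riemannZeta_def_of_ne_zero hs0,
      mul_div_cancel₀ _ (Gammaℝ_ne_zero_of_re_pos hs)]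
  have hval : completedRiemannZeta (1 / 2 + t * I)
    = Gammaℝ (1 / 2 + t * I) * riemannZeta (1 / 2 + t * I) := hloc.self_of_nhds
  have hder := (hp.congr_of_eventuallyEq hloc).deriv
  have hre := zh_Lambda_deriv t ht
  have him := zh_Lambda_real t ht
  have key : zhangEta (1 / 2 + t * I) = deriv completedRiemannZeta (1 / 2 + t * I)
      - d * completedRiemannZeta (1 / 2 + t * I) := by
    rw [hder, hval, zh_eta_eq]; ring
  rw [key, Complex.sub_re, Complex.mul_re, hre, him]
  ring

lemma zh_eta_analytic (t : ℝ) (ht : 7 < t) : AnalyticAt ℂ zhangEta (1 / 2 + t * I) := by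
  have hU : IsOpen ({s : ℂ | 0 < s.re} ∩ {1}ᶜ) :=
    (isOpen_lt continuous_const Complex.continuous_re).inter isOpen_compl_singleton
  have hpi : (Real.pi : ℂ) ≠ 0 := by exact_mod_cast Real.pi_ne_zero
  have hd : DifferentiableOn ℂ zhangEta ({s : ℂ | 0 < s.re} ∩ {1}ᶜ) := by
    intro s hs
    have h1 : DifferentiableAt ℂ (fun s : ℂ => (Real.pi : ℂ) ^ (-s / 2)) s :=
      DifferentiableAt.const_cpow (by fun_prop) (Or.inl hpi)
    have h2 : DifferentiableAt ℂ (fun s : ℂ => Gamma (s / 2)) s := by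
      refine DifferentiableAt.comp (g := Gamma) s (differentiableAt_Gamma _ ?_) (by fun_prop)
      intro m h
      have h3 := congrArg Complex.re h
      have h4 : 0 < s.re := hs.1
      rw [Complex.div_ofNat_re, Complex.neg_re, Complex.natCast_re] at h3
      have : (0 : ℝ) ≤ m := m.cast_nonneg
      linarith
    have h3 : DifferentiableAt ℂ (deriv riemannZeta) s :=
      ((analyticOn_riemannZeta s hs.2).deriv).differentiableAt
    exact ((h1.mul h2).mul h3).differentiableWithinAt
  exact hd.analyticAt (hU.mem_nhds ⟨by simp, zh_ne_one t⟩)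

theorem integral_F_between_consecutive_zeros
    (hRH : RiemannHypothesis)
    (hF : ∀ t : ℝ, 7 < t → 0 < zhangF t)
    (γ γ' : ℝ) (hγ7 : 7 < γ) (hγγ' : γ < γ')
    (hz : riemannZeta (1 / 2 + γ * I) = 0)
    (hz' : riemannZeta (1 / 2 + γ' * I) = 0)
    (hcons : ∀ t : ℝ, γ < t → t < γ' → riemannZeta (1 / 2 + t * I) ≠ 0) :
    (∫ t in γ..γ', zhangF t) = Real.pi := by
  have hne : ∀ t : ℝ, 7 < t → zhangEta (1 / 2 + t * I) ≠ 0 := by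
    intro t ht h
    have := hF t ht
    rw [zhangF, h, div_zero, Complex.zero_re, neg_zero] at this
    exact lt_irrefl _ this
  have hgne : ∀ t : ℝ, Gammaℝ (1 / 2 + t * I) ≠ 0 := fun t =>
    Gammaℝ_ne_zero_of_re_pos (by simp)
  set f : ℝ → ℝ := fun t => (completedRiemannZeta (1 / 2 + t * I)).re with hf
  have hfc : Continuous f := by
    refine continuous_iff_continuousAt.mpr fun t => ?_
    have h1 := (differentiableAt_completedZeta (zh_ne_zero t) (zh_ne_one t)).continuousAt
    have h2 : ContinuousAt (fun t : ℝ => completedRiemannZeta (1 / 2 + t * I)) t :=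
      ContinuousAt.comp (g := completedRiemannZeta) h1 (zh_path t).continuousAt
    exact Complex.continuous_re.continuousAt.comp h2
  have hf0 : ∀ t : ℝ, 7 < t → (f t = 0 ↔ riemannZeta (1 / 2 + t * I) = 0) := by
    intro t ht
    have him := zh_Lambda_real t ht
    rw [riemannZeta_def_of_ne_zero (zh_ne_zero t), div_eq_zero_iff]
    constructor
    · intro h; exact Or.inl (Complex.ext h him)
    · rintro (h | h)
      · simp only [hf, h, Complex.zero_re]
      · exact absurd h (hgne t)
  have hfγ : f γ = 0 := (hf0 γ hγ7).mpr hz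
  have hfγ' : f γ' = 0 := (hf0 γ' (hγ7.trans hγγ')).mpr hz'
  obtain ⟨σ, hσ, hσf⟩ : ∃ σ : ℝ, (σ = 1 ∨ σ = -1) ∧ ∀ t ∈ Set.Ioo γ γ', 0 < σ * -f t := by
    have hn : ∀ t ∈ Set.Ioo γ γ', f t ≠ 0 := fun t ht h =>
      hcons t ht.1 ht.2 ((hf0 t (hγ7.trans ht.1)).mp h)
    have hc : IsPreconnected (Set.Ioo γ γ') := isPreconnected_Ioo
    obtain ⟨m, hm⟩ := Set.nonempty_Ioo.mpr hγγ'
    rcases lt_or_gt_of_ne (hn m hm) with hm0 | hm0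
    · refine ⟨1, Or.inl rfl, fun t ht => ?_⟩
      by_contra hcon
      have h0 : 0 ≤ f t := by linarith
      obtain ⟨u, hu, hu0⟩ := hc.intermediate_value hm ht hfc.continuousOn ⟨hm0.le, h0⟩
      exact hn u hu hu0
    · refine ⟨-1, Or.inr rfl, fun t ht => ?_⟩
      by_contra hcon
      have h0 : f t ≤ 0 := by linarith
      obtain ⟨u, hu, hu0⟩ := hc.intermediate_value ht hm hfc.continuousOn ⟨h0, hm0.le⟩
      exact hn u hu hu0
  have hσ0 : (σ : ℂ) ≠ 0 := by rcases hσ with h | h <;> simp [h]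
  set w : ℝ → ℂ := fun t => σ * zhangEta (1 / 2 + t * I) with hw
  have hwd : ∀ t : ℝ, 7 < t → HasDerivAt w (σ * (deriv zhangEta (1 / 2 + t * I) * I)) t := by
    intro t ht
    exact (HasDerivAt.comp t (h₂ := zhangEta)
      (zh_eta_analytic t ht).differentiableAt.hasDerivAt (zh_path t)).const_mul (σ : ℂ)
  have hwne : ∀ t : ℝ, 7 < t → w t ≠ 0 := fun t ht => mul_ne_zero hσ0 (hne t ht)
  have hwre : ∀ t : ℝ, 7 < t → ∃ c : ℝ, 0 < c ∧ (w t).re = c * (σ * -f t) := by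
    intro t ht
    obtain ⟨c, hc, h⟩ := zh_eta_re t ht
    refine ⟨c, hc, ?_⟩
    simp only [hw, Complex.re_ofReal_mul, h, hf]
    ring
  have hwγ : (w γ).re = 0 := by
    obtain ⟨c, _, h⟩ := hwre γ hγ7
    rw [h, hfγ]; simp
  have hwγ' : (w γ').re = 0 := by
    obtain ⟨c, _, h⟩ := hwre γ' (hγ7.trans hγγ')
    rw [h, hfγ']; simp
  have him0 : ∀ t : ℝ, 7 < t → (w t).re = 0 → (w t).im ≠ 0 := fun t ht h h' =>
    hwne t ht (Complex.ext h h')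
  have hslit : ∀ t ∈ Set.Icc γ γ', w t ∈ slitPlane := by
    intro t ht
    have ht7 : 7 < t := hγ7.trans_le ht.1
    rcases eq_or_lt_of_le ht.1 with h | h
    · subst h; exact Or.inr (him0 _ ht7 hwγ)
    rcases eq_or_lt_of_le ht.2 with h' | h'
    · subst h'; exact Or.inr (him0 _ ht7 hwγ')
    obtain ⟨c, hc, hcw⟩ := hwre t ht7
    exact Or.inl (by rw [hcw]; exact mul_pos hc (hσf t ⟨h, h'⟩))
  have hA : ∀ t ∈ Set.uIcc γ γ', HasDerivAt (fun t => -(Complex.log (w t)).im) (zhangF t) t := by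
    intro t ht
    rw [Set.uIcc_of_le hγγ'.le] at ht
    have ht7 : 7 < t := hγ7.trans_le ht.1
    have h1 := (hwd t ht7).clog_real (hslit t ht)
    have h2 : HasDerivAt (fun t => (Complex.log (w t)).im)
      ((σ * (deriv zhangEta (1 / 2 + t * I) * I)) / w t).im t :=
      (Complex.imCLM.hasFDerivAt.comp_hasDerivAt t h1)
    refine h2.neg.congr_deriv ?_
    rw [hw, zhangF, mul_div_mul_left _ _ hσ0, mul_div_right_comm, Complex.mul_I_im]
  have hcont : ContinuousOn zhangF (Set.uIcc γ γ') := by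
    intro t ht
    rw [Set.uIcc_of_le hγγ'.le] at ht
    have ht7 : 7 < t := hγ7.trans_le ht.1
    have ha := zh_eta_analytic t ht7
    have h1 : ContinuousAt (fun s => deriv zhangEta s / zhangEta s) (1 / 2 + t * I) :=
      ha.deriv.continuousAt.div ha.continuousAt (hne t ht7)
    have h2 : ContinuousAt (fun t : ℝ => deriv zhangEta (1 / 2 + t * I) / zhangEta (1 / 2 + t * I)) t :=
      ContinuousAt.comp (g := fun s => deriv zhangEta s / zhangEta s) h1 (zh_path t).continuousAt
    exact ((Complex.continuous_re.continuousAt.comp h2).neg).continuousWithinAt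
  have hint : IntervalIntegrable zhangF volume γ γ' := hcont.intervalIntegrable
  have hpos : 0 < ∫ t in γ..γ', zhangF t :=
    intervalIntegral.intervalIntegral_pos_of_pos_on hint
      (fun t ht => hF t (hγ7.trans ht.1)) hγγ'
  have hval := intervalIntegral.integral_eq_sub_of_hasDerivAt hA hint
  simp only [Complex.log_im] at hval
  have harg : ∀ t : ℝ, 7 < t → (w t).re = 0 →
      (w t).arg = Real.pi / 2 ∨ (w t).arg = -(Real.pi / 2) := by
    intro t ht h
    rcases lt_or_gt_of_ne (him0 t ht h) with h' | h'
    · right; rw [Complex.arg_eq_neg_pi_div_two_iff.mpr ⟨h, h'⟩]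
    · left; exact Complex.arg_eq_pi_div_two_iff.mpr ⟨h, h'⟩
  have hpi := Real.pi_pos
  rw [hval] at hpos ⊢
  rcases harg γ hγ7 hwγ with h1 | h1 <;>
    rcases harg γ' (hγ7.trans hγγ') hwγ' with h2 | h2 <;>
    rw [h1, h2] at hpos ⊢ <;> linarith
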